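/- arXiv:2511.11488 — 3 statements merged into one kernel-verified Lean document; each statement's English description precedes it below -/
import Mathlib

section
/- Pathwise dominance of the OR system by the UB system: for all n ≥ 0, the following five inequalities hold simultaneously: Q₁⁻(n) ≤ Q̂₁⁻(n); Q₁⁺(n) ≤ Q̂₁⁺(n); Q₂(n) ≤ Q̂₂(n); Q₁(n) + R₁(n) ≤ Q̂₁(n) + R̂₁(n); and R₂(n) + R₃(n) ≤ R̂₂(n) + R̂₃(n). -/
/-!
Discrete-event coupled N-model with a deterministic waiting-time threshold `T` on
the diagonal.  Events are indexed `1, 2, 3, …` and occur at strictly increasing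
times `t 1 < t 2 < …`.  Jobs are identified with the index of their arrival event.
The five kinds of events are: a type-1 arrival, a type-2 arrival, the waiting time
of the type-1 job that arrived at event `k` reaching the threshold `T`, a potential
service completion at server 1, and a potential service completion at server 2.
-/

inductive NEvent : Type
  /-- (i) arrival of a new type-1 job -/
  | arr1 : NEvent
  /-- (ii) arrival of a new type-2 job -/
  | arr2 : NEvent
  /-- (iii) the waiting time of the type-1 job that arrived at event `k` reaches `T` -/
  | thresh : ℕ → NEvent
  /-- (iv) a potential service completion at server 1 -/
  | dep1 : NEvent
  /-- (v) a potential service completion at server 2 -/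
  | dep2 : NEvent
  deriving DecidableEq

/-- The state of one of the two systems after an event: the set `q1m` of waiting
type-1 jobs with current waiting time `< T`, the set `q1p` of waiting type-1 jobs
with waiting time `≥ T`, the set `q2` of waiting type-2 jobs (all recorded by the
index of the job's arrival event; smaller index = earlier arrival), and the jobs
(if any) in service at server 1 and at server 2. -/
structure NState : Type where
  q1m : Finset ℕ
  q1p : Finset ℕ
  q2 : Finset ℕ
  s1 : Option ℕ
  s2 : Option ℕ

/-- Both systems start empty. -/
def NState.empty : NState := ⟨∅, ∅, ∅, none, none⟩

/-- Transition of the OR system at event index `n` .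
Server 1 may serve any waiting type-1 job; server 2 may serve waiting type-2 jobs
and waiting type-1 jobs whose waiting time is at least `T` (i.e. members of `q1p`).
Servers are non-idling and FCFS: an idle server immediately takes the eligible job
with the earliest arrival (= least index); at a potential service completion the job
in service (if any) departs and the freed server takes the earliest eligible waiting job. -/
def orStep (n : ℕ) (ev : NEvent) (s : NState) : NState :=
  match ev with
  | NEvent.arr1 =>
      if s.s1 = none ∧ s.q1m = ∅ ∧ s.q1p = ∅ then { s with s1 := some n }
      else { s with q1m := insert n s.q1m }
  | NEvent.arr2 =>
      if s.s2 = none ∧ s.q1p = ∅ ∧ s.q2 = ∅ then { s with s2 := some n }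
      else { s with q2 := insert n s.q2 }
  | NEvent.thresh k =>
      if k ∈ s.q1m then
        let s' : NState := { s with q1m := s.q1m.erase k }
        if s'.s2 = none ∧ s'.q1p = ∅ ∧ s'.q2 = ∅ then { s' with s2 := some k }
        else if s'.s1 = none ∧ s'.q1p = ∅ then { s' with s1 := some k }
        else { s' with q1p := insert k s'.q1p }
      else s
  | NEvent.dep1 =>
      match s.s1 with
      | none => s
      | some _ =>
          if h : (s.q1m ∪ s.q1p).Nonempty then
            let j := (s.q1m ∪ s.q1p).min' h
            { s with s1 := some j, q1m := s.q1m.erase j, q1p := s.q1p.erase j }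
          else { s with s1 := none }
  | NEvent.dep2 =>
      match s.s2 with
      | none => s
      | some _ =>
          if h : (s.q1p ∪ s.q2).Nonempty then
            let j := (s.q1p ∪ s.q2).min' h
            { s with s2 := some j, q1p := s.q1p.erase j, q2 := s.q2.erase j }
          else { s with s2 := none }

/-- Transition of the UB system at event index `n`.  Identical to the OR system,
except that server 1, too, may take a type-1 job into service only once that job's
waiting time is at least `T` (so a type-1 arrival always joins `q1m`, and server 1
serves only jobs of `q1p`), and a type-1 job reaching waiting time `T` that finds
both servers idle is taken into service by server 1. -/
def ubStep (n : ℕ) (ev : NEvent) (s : NState) : NState :=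
  match ev with
  | NEvent.arr1 => { s with q1m := insert n s.q1m }
  | NEvent.arr2 =>
      if s.s2 = none ∧ s.q1p = ∅ ∧ s.q2 = ∅ then { s with s2 := some n }
      else { s with q2 := insert n s.q2 }
  | NEvent.thresh k =>
      if k ∈ s.q1m then
        let s' : NState := { s with q1m := s.q1m.erase k }
        if s'.s1 = none ∧ s'.q1p = ∅ then { s' with s1 := some k }
        else if s'.s2 = none ∧ s'.q1p = ∅ ∧ s'.q2 = ∅ then { s' with s2 := some k }
        else { s' with q1p := insert k s'.q1p }
      else s
  | NEvent.dep1 =>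
      match s.s1 with
      | none => s
      | some _ =>
          if h : s.q1p.Nonempty then
            let j := s.q1p.min' h
            { s with s1 := some j, q1p := s.q1p.erase j }
          else { s with s1 := none }
  | NEvent.dep2 =>
      match s.s2 with
      | none => s
      | some _ =>
          if h : (s.q1p ∪ s.q2).Nonempty then
            let j := (s.q1p ∪ s.q2).min' h
            { s with s2 := some j, q1p := s.q1p.erase j, q2 := s.q2.erase j }
          else { s with s2 := none }

/-- A driving sequence for the coupled N-model: a threshold `T > 0`, strictly
increasing positive event times `t 1 < t 2 < …` (with `t 0 = 0` as a convention;
index `0` carries no event), and events `e 1, e 2, …` such that a threshold event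
`thresh k` at event index `n` says the type-1 job that arrived at event `k`
(at time `t n - T`) reaches waiting time `T`, and every type-1 arrival has exactly
one threshold event, `T` time units after its arrival (uniqueness is automatic
from `t n = t k + T` and strict monotonicity of the times). -/
structure NDriving : Type where
  T : ℝ
  hT : 0 < T
  t : ℕ → ℝ
  e : ℕ → NEvent
  ht0 : t 0 = 0
  hmono : StrictMono t
  hthresh : ∀ n k, 1 ≤ n → e n = NEvent.thresh k →
      1 ≤ k ∧ k < n ∧ e k = NEvent.arr1 ∧ t n = t k + T
  hthresh_ex : ∀ k, 1 ≤ k → e k = NEvent.arr1 → ∃ n, 1 ≤ n ∧ e n = NEvent.thresh k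

/-- The state of the OR system after `n` events (`n = 0` is the empty initial state). -/
def orTraj (D : NDriving) : ℕ → NState
  | 0 => NState.empty
  | n + 1 => orStep (n + 1) (D.e (n + 1)) (orTraj D n)

/-- The state of the UB system after `n` events. -/
def ubTraj (D : NDriving) : ℕ → NState
  | 0 => NState.empty
  | n + 1 => ubStep (n + 1) (D.e (n + 1)) (ubTraj D n)

/-- `Q₁⁻(n)`: number of waiting type-1 jobs with waiting time `< T` in the OR system. -/
def orQ1m (D : NDriving) (n : ℕ) : ℕ := (orTraj D n).q1m.card

/-- `Q₁⁺(n)`: number of waiting type-1 jobs with waiting time `≥ T` in the OR system. -/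
def orQ1p (D : NDriving) (n : ℕ) : ℕ := (orTraj D n).q1p.card

/-- `Q₂(n)`: number of waiting type-2 jobs in the OR system. -/
def orQ2 (D : NDriving) (n : ℕ) : ℕ := (orTraj D n).q2.card

/-- `Q₁(n) = Q₁⁻(n) + Q₁⁺(n)`. -/
def orQ1 (D : NDriving) (n : ℕ) : ℕ := orQ1m D n + orQ1p D n

/-- `R₁(n) ∈ {0,1}`: 1 iff server 1 of the OR system is busy. -/
def orR1 (D : NDriving) (n : ℕ) : ℕ := if (orTraj D n).s1 = none then 0 else 1

/-- `R₂(n) ∈ {0,1}`: 1 iff server 2 of the OR system is busy serving a type-2 job. -/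
def orR2 (D : NDriving) (n : ℕ) : ℕ :=
  match (orTraj D n).s2 with
  | none => 0
  | some j => if D.e j = NEvent.arr2 then 1 else 0

/-- `R₃(n) ∈ {0,1}`: 1 iff server 2 of the OR system is busy serving a type-1 job. -/
def orR3 (D : NDriving) (n : ℕ) : ℕ :=
  match (orTraj D n).s2 with
  | none => 0
  | some j => if D.e j = NEvent.arr1 then 1 else 0

/-- `Q̂₁⁻(n)` for the UB system. -/
def ubQ1m (D : NDriving) (n : ℕ) : ℕ := (ubTraj D n).q1m.card

/-- `Q̂₁⁺(n)` for the UB system. -/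
def ubQ1p (D : NDriving) (n : ℕ) : ℕ := (ubTraj D n).q1p.card

/-- `Q̂₂(n)` for the UB system. -/
def ubQ2 (D : NDriving) (n : ℕ) : ℕ := (ubTraj D n).q2.card

/-- `Q̂₁(n) = Q̂₁⁻(n) + Q̂₁⁺(n)`. -/
def ubQ1 (D : NDriving) (n : ℕ) : ℕ := ubQ1m D n + ubQ1p D n

/-- `R̂₁(n)` for the UB system. -/
def ubR1 (D : NDriving) (n : ℕ) : ℕ := if (ubTraj D n).s1 = none then 0 else 1

/-- `R̂₂(n)` for the UB system. -/
def ubR2 (D : NDriving) (n : ℕ) : ℕ :=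
  match (ubTraj D n).s2 with
  | none => 0
  | some j => if D.e j = NEvent.arr2 then 1 else 0

/-- `R̂₃(n)` for the UB system. -/
def ubR3 (D : NDriving) (n : ℕ) : ℕ :=
  match (ubTraj D n).s2 with
  | none => 0
  | some j => if D.e j = NEvent.arr1 then 1 else 0

theorem erase_subset_erase_of_le {A B : Finset ℕ} {x y : ℕ} (h : A ⊆ B) (hxy : x ≤ y)
    (hy : ∀ i ∈ A, y ≤ i) : A.erase y ⊆ B.erase x := by
  intro w hw
  obtain ⟨hne, hwA⟩ := Finset.mem_erase.1 hw
  have := hy w hwA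
  exact Finset.mem_erase.2 ⟨by omega, h hwA⟩

/-- The inductive invariant behind the pathwise dominance: `s` is the OR state and `u` the UB state
after `n` events of the event sequence `e`.  Besides the set inclusions, the crucial parts are
`upper` (by FCFS, the waiting type-1 jobs below the threshold in the OR system are the most recent
ones of the UB system) and the counting inequality `count`. -/
structure Coupled (e : ℕ → NEvent) (n : ℕ) (s u : NState) : Prop where
  q1m_subset : s.q1m ⊆ u.q1m
  q1p_subset : s.q1p ⊆ u.q1p
  q2_subset : s.q2 ⊆ u.q2
  upper : ∀ i ∈ s.q1m, ∀ j ∈ u.q1m, i < j → j ∈ s.q1m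
  older : ∀ i ∈ s.q1p, ∀ j ∈ s.q1m, i < j
  q1m_arr : ∀ j ∈ u.q1m, e j = NEvent.arr1 ∧ 1 ≤ j ∧ j ≤ n
  q1p_arr : ∀ j ∈ u.q1p, e j = NEvent.arr1 ∧ j ≤ n
  q2_arr : ∀ j ∈ u.q2, e j = NEvent.arr2
  s2_arr : ∀ j, u.s2 = some j → e j = NEvent.arr1 ∨ e j = NEvent.arr2
  or_idle1 : s.s1 = none → s.q1m = ∅ ∧ s.q1p = ∅
  or_idle2 : s.s2 = none → s.q1p = ∅ ∧ s.q2 = ∅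
  ub_idle1 : u.s1 = none → u.q1p = ∅
  ub_idle2 : u.s2 = none → u.q1p = ∅ ∧ u.q2 = ∅
  busy2 : u.s2 = none → s.s2 = none
  count : s.q1m.card + s.q1p.card + (if s.s1 = none then 0 else 1) ≤
    u.q1m.card + u.q1p.card + (if u.s1 = none then 0 else 1)
  disjoint : ∀ j ∈ u.q1m, j ∉ u.q1p
  no_thresh : ∀ j ∈ u.q1m, ∀ m, 1 ≤ m → m ≤ n → e m ≠ NEvent.thresh j

namespace Coupled

variable {e : ℕ → NEvent} {n : ℕ} {s u : NState}

/-- If the type-1 job reaching the threshold is the oldest one below it and still waits in the OR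
system, then server 1 of the UB system is busy. -/
theorem ub_busy1 (h : Coupled e n s u) {k : ℕ} (hk : k ∈ s.q1m) (hmin : ∀ j ∈ u.q1m, k ≤ j) :
    u.s1 ≠ none := by
  intro hu
  have heq : s.q1m = u.q1m := by
    refine h.q1m_subset.antisymm fun j hj => ?_
    rcases (hmin j hj).eq_or_lt with rfl | hlt
    · exact hk
    · exact h.upper k hk j hj hlt
  have hs : s.s1 ≠ none := fun hs => by simp [(h.or_idle1 hs).1] at hk
  have hc := h.count
  simp only [heq, hu, hs, h.ub_idle1 hu, if_true, if_false, Finset.card_empty] at hc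
  omega

theorem arr1 (h : Coupled e n s u) (he : e (n + 1) = NEvent.arr1)
    (hnew : ∀ m, 1 ≤ m → m ≤ n + 1 → e m ≠ NEvent.thresh (n + 1)) :
    Coupled e (n + 1) (orStep (n + 1) NEvent.arr1 s) (ubStep (n + 1) NEvent.arr1 u) := by
  have hnu : n + 1 ∉ u.q1m := fun hn => by have := (h.q1m_arr _ hn).2.2; omega
  have hns : n + 1 ∉ s.q1m := fun hn => hnu (h.q1m_subset hn)
  have hcu := Finset.card_insert_of_notMem hnu
  have hcs := Finset.card_insert_of_notMem hns
  obtain ⟨a1, a2, a3, a4, a5, a6, a7, a8, a9, a10, a11, a12, a13, a14, a15, a17, a16⟩ := h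
  simp only [orStep, ubStep]
  split_ifs with hc
  · constructor <;> grind
  · constructor <;> grind

theorem arr2 (h : Coupled e n s u) (he : e (n + 1) = NEvent.arr2) :
    Coupled e (n + 1) (orStep (n + 1) NEvent.arr2 s) (ubStep (n + 1) NEvent.arr2 u) := by
  obtain ⟨a1, a2, a3, a4, a5, a6, a7, a8, a9, a10, a11, a12, a13, a14, a15, a17, a16⟩ := h
  simp only [orStep, ubStep]
  split_ifs with hc hd
  all_goals constructor <;> grind

set_option maxHeartbeats 1000000 in
theorem thresh (h : Coupled e n s u) {k : ℕ} (he : e (n + 1) = NEvent.thresh k)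
    (hmin : ∀ j ∈ u.q1m, k ≤ j) :
    Coupled e (n + 1) (orStep (n + 1) (NEvent.thresh k) s)
      (ubStep (n + 1) (NEvent.thresh k) u) := by
  have hb : k ∈ s.q1m → u.s1 ≠ none := fun hk => h.ub_busy1 hk hmin
  have hpm := Finset.card_le_card h.q1p_subset
  have hmm : k ∉ s.q1m → s.q1m.card ≤ (u.q1m.erase k).card := fun hk =>
    Finset.card_le_card fun j hj => by grind [h.q1m_subset hj]
  obtain ⟨a1, a2, a3, a4, a5, a6, a7, a8, a9, a10, a11, a12, a13, a14, a15, a17, a16⟩ := h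
  have hcs : k ∈ s.q1m → (s.q1m.erase k).card + 1 = s.q1m.card := Finset.card_erase_add_one
  have hcu : k ∈ u.q1m → (u.q1m.erase k).card + 1 = u.q1m.card := Finset.card_erase_add_one
  have hku : k ∈ u.q1m → (insert k u.q1p).card = u.q1p.card + 1 := fun hk =>
    Finset.card_insert_of_notMem (a17 k hk)
  have hps := Finset.card_insert_le k s.q1p
  simp only [orStep, ubStep]
  split_ifs
  all_goals
    constructor
    case count =>
      have := Finset.card_eq_zero (s := s.q1p)
      have := Finset.card_eq_zero (s := u.q1p)
      clear a4 a5 a6 a7 a8 a9 a16 a17 hmin he a3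
      grind
    all_goals
      clear hcs hcu hpm hmm hps hku a15
      grind

theorem upper_erase (h : Coupled e n s u) {y : ℕ} (hy : ∀ i ∈ s.q1m ∪ s.q1p, y ≤ i) :
    ∀ i ∈ s.q1m.erase y, ∀ j ∈ u.q1m, i < j → j ∈ s.q1m.erase y := by
  intro i hi j hj hij
  have him := Finset.mem_of_mem_erase hi
  have hyi := hy i (Finset.mem_union_left _ him)
  exact Finset.mem_erase.2 ⟨by omega, h.upper i him j hj hij⟩

theorem orStep_dep1 (h : Coupled e n s u) (m : ℕ) :
    (s.q1m = ∅ ∧ s.q1p = ∅ ∧ orStep m NEvent.dep1 s = { s with s1 := none }) ∨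
    ∃ y, s.s1 ≠ none ∧ (y ∈ s.q1m ∨ y ∈ s.q1p) ∧ (∀ i ∈ s.q1m ∪ s.q1p, y ≤ i) ∧
      orStep m NEvent.dep1 s =
        { s with s1 := some y, q1m := s.q1m.erase y, q1p := s.q1p.erase y } := by
  have hi := h.or_idle1
  cases s with | mk q1m q1p q2 s1 s2 =>
  cases s1 with
  | none => exact .inl ⟨(hi rfl).1, (hi rfl).2, rfl⟩
  | some a =>
    by_cases hne : (q1m ∪ q1p).Nonempty
    · exact .inr ⟨(q1m ∪ q1p).min' hne, by simp, Finset.mem_union.1 (Finset.min'_mem _ _),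
        fun i hi => Finset.min'_le _ i hi, by simp [orStep, hne]⟩
    · obtain ⟨h1, h2⟩ := Finset.union_eq_empty.1 (Finset.not_nonempty_iff_eq_empty.1 hne)
      exact .inl ⟨h1, h2, by simp [orStep, h1, h2]⟩

theorem ubStep_dep1 (h : Coupled e n s u) (m : ℕ) :
    (u.q1p = ∅ ∧ ubStep m NEvent.dep1 u = { u with s1 := none }) ∨
    ∃ x, u.s1 ≠ none ∧ x ∈ u.q1p ∧ (∀ i ∈ u.q1p, x ≤ i) ∧
      ubStep m NEvent.dep1 u = { u with s1 := some x, q1p := u.q1p.erase x } := by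
  have hi := h.ub_idle1
  cases u with | mk q1m q1p q2 s1 s2 =>
  cases s1 with
  | none => exact .inl ⟨hi rfl, rfl⟩
  | some a =>
    by_cases hne : q1p.Nonempty
    · exact .inr ⟨q1p.min' hne, by simp, Finset.min'_mem _ _,
        fun i hi => Finset.min'_le _ i hi, by simp [ubStep, hne]⟩
    · have h1 := Finset.not_nonempty_iff_eq_empty.1 hne
      exact .inl ⟨h1, by simp [ubStep, h1]⟩

theorem orStep_dep2 (h : Coupled e n s u) (m : ℕ) :
    (s.q1p = ∅ ∧ s.q2 = ∅ ∧ orStep m NEvent.dep2 s = { s with s2 := none }) ∨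
    ∃ y, s.s2 ≠ none ∧ (y ∈ s.q1p ∨ y ∈ s.q2) ∧ (∀ i ∈ s.q1p ∪ s.q2, y ≤ i) ∧
      orStep m NEvent.dep2 s =
        { s with s2 := some y, q1p := s.q1p.erase y, q2 := s.q2.erase y } := by
  have hi := h.or_idle2
  cases s with | mk q1m q1p q2 s1 s2 =>
  cases s2 with
  | none => exact .inl ⟨(hi rfl).1, (hi rfl).2, rfl⟩
  | some a =>
    by_cases hne : (q1p ∪ q2).Nonempty
    · exact .inr ⟨(q1p ∪ q2).min' hne, by simp, Finset.mem_union.1 (Finset.min'_mem _ _),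
        fun i hi => Finset.min'_le _ i hi, by simp [orStep, hne]⟩
    · obtain ⟨h1, h2⟩ := Finset.union_eq_empty.1 (Finset.not_nonempty_iff_eq_empty.1 hne)
      exact .inl ⟨h1, h2, by simp [orStep, h1, h2]⟩

theorem ubStep_dep2 (h : Coupled e n s u) (m : ℕ) :
    (u.q1p = ∅ ∧ u.q2 = ∅ ∧ ubStep m NEvent.dep2 u = { u with s2 := none }) ∨
    ∃ x, u.s2 ≠ none ∧ (x ∈ u.q1p ∨ x ∈ u.q2) ∧ (∀ i ∈ u.q1p ∪ u.q2, x ≤ i) ∧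
      ubStep m NEvent.dep2 u =
        { u with s2 := some x, q1p := u.q1p.erase x, q2 := u.q2.erase x } := by
  have hi := h.ub_idle2
  cases u with | mk q1m q1p q2 s1 s2 =>
  cases s2 with
  | none => exact .inl ⟨(hi rfl).1, (hi rfl).2, rfl⟩
  | some a =>
    by_cases hne : (q1p ∪ q2).Nonempty
    · exact .inr ⟨(q1p ∪ q2).min' hne, by simp, Finset.mem_union.1 (Finset.min'_mem _ _),
        fun i hi => Finset.min'_le _ i hi, by simp [ubStep, hne]⟩
    · obtain ⟨h1, h2⟩ := Finset.union_eq_empty.1 (Finset.not_nonempty_iff_eq_empty.1 hne)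
      exact .inl ⟨h1, h2, by simp [ubStep, h1, h2]⟩

theorem dep1 (h : Coupled e n s u) (he : e (n + 1) = NEvent.dep1) :
    Coupled e (n + 1) (orStep (n + 1) NEvent.dep1 s) (ubStep (n + 1) NEvent.dep1 u) := by
  have hup := fun y => h.upper_erase (y := y)
  have hor := h.orStep_dep1 (n + 1)
  have hub := h.ubStep_dep1 (n + 1)
  obtain ⟨a1, a2, a3, a4, a5, a6, a7, a8, a9, a10, a11, a12, a13, a14, a15, a17, a16⟩ := h
  rcases hor with ⟨hm, hp, hor⟩ | ⟨y, hs1, hy, hyl, hor⟩ <;>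
    rcases hub with ⟨hup', hub⟩ | ⟨x, hu1, hx, hxl, hub⟩ <;> rw [hor, hub] <;> constructor
  case inr.inl.upper | inr.inr.upper => exact hup y hyl
  case inl.inl.count | inl.inr.count => simp [hm, hp]
  case inr.inl.count =>
    have hp : s.q1p = ∅ := Finset.subset_empty.1 (hup' ▸ a2)
    have hcs := Finset.card_erase_add_one (hy.resolve_right (by simp [hp]))
    simp only [hs1, hp, hup', if_false, if_true, Finset.card_empty, Finset.erase_empty,
      reduceCtorEq] at a15 ⊢
    split_ifs at a15 <;> omega
  case inr.inr.count =>
    have hcu := Finset.card_erase_add_one hx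
    have hcs : (s.q1m.erase y).card + (s.q1p.erase y).card + 1 ≤ s.q1m.card + s.q1p.card := by
      rcases hy with hy | hy
      · have := Finset.card_erase_add_one hy
        have := Finset.card_erase_le (s := s.q1p) (a := y)
        omega
      · have := Finset.card_erase_add_one hy
        have := Finset.card_erase_le (s := s.q1m) (a := y)
        omega
    simp only [hs1, hu1, if_false, reduceCtorEq] at a15 ⊢
    omega
  all_goals
    clear hup a15
    grind

theorem dep2 (h : Coupled e n s u) (he : e (n + 1) = NEvent.dep2) :
    Coupled e (n + 1) (orStep (n + 1) NEvent.dep2 s) (ubStep (n + 1) NEvent.dep2 u) := by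
  have hmm := Finset.card_le_card h.q1m_subset
  have hor := h.orStep_dep2 (n + 1)
  have hub := h.ubStep_dep2 (n + 1)
  obtain ⟨a1, a2, a3, a4, a5, a6, a7, a8, a9, a10, a11, a12, a13, a14, a15, a17, a16⟩ := h
  have hbusy : u.q1p ≠ ∅ → u.s1 ≠ none := mt a12
  rcases hor with ⟨hp, hq, hor⟩ | ⟨y, hs2, hy, hyl, hor⟩ <;>
    rcases hub with ⟨hup, huq, hub⟩ | ⟨x, hu2, hx, hxl, hub⟩ <;> rw [hor, hub] <;> constructor
  case inr.inr.q1p_subset =>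
    exact erase_subset_erase_of_le a2 (hxl y (Finset.mem_union.2 (hy.imp (@a2 y) (@a3 y))))
      fun i hi => hyl i (Finset.mem_union_left _ hi)
  case inr.inr.q2_subset =>
    exact erase_subset_erase_of_le a3 (hxl y (Finset.mem_union.2 (hy.imp (@a2 y) (@a3 y))))
      fun i hi => hyl i (Finset.mem_union_right _ hi)
  case inl.inl.count => exact a15
  case inr.inl.count =>
    have := Finset.card_erase_le (s := s.q1p) (a := y)
    dsimp only
    omega
  case inl.inr.count =>
    by_cases hxp : x ∈ u.q1p
    · have hu1 := hbusy (Finset.ne_empty_of_mem hxp)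
      simp only [hp, hu1, if_false, Finset.card_empty]
      split_ifs <;> omega
    · simpa only [Finset.erase_eq_of_notMem hxp] using a15
  case inr.inr.count =>
    have hle := Finset.card_erase_le (s := s.q1p) (a := y)
    by_cases hxp : x ∈ u.q1p
    · have hu1 := hbusy (Finset.ne_empty_of_mem hxp)
      have hxy : x ≤ y := hxl y (Finset.mem_union.2 (hy.imp (@a2 y) (@a3 y)))
      have := Finset.card_le_card <| erase_subset_erase_of_le a2 hxy fun i hi =>
        hyl i (Finset.mem_union_left _ hi)
      simp only [hu1, if_false]
      split_ifs <;> omega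
    · simp only [Finset.erase_eq_of_notMem hxp]
      omega
  all_goals
    clear hmm a15
    grind

end Coupled

theorem coupled_traj (D : NDriving) (n : ℕ) : Coupled D.e n (orTraj D n) (ubTraj D n) := by
  induction n with
  | zero => constructor <;> simp [orTraj, ubTraj, NState.empty]
  | succ n ih =>
    simp only [orTraj, ubTraj]
    cases he : D.e (n + 1) with
    | arr1 =>
      refine ih.arr1 he fun m hm hmn hem => ?_
      have := (D.hthresh m _ hm hem).2.1
      omega
    | arr2 => exact ih.arr2 he
    | thresh k =>
      refine ih.thresh he fun j hj => ?_
      by_contra! hlt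
      obtain ⟨harr, hj1, -⟩ := ih.q1m_arr j hj
      obtain ⟨m, hm, hem⟩ := D.hthresh_ex j hj1 harr
      refine ih.no_thresh j hj m hm ?_ hem
      have h1 := (D.hthresh m j hm hem).2.2.2
      have h2 := (D.hthresh (n + 1) k (by omega) he).2.2.2
      have h3 : D.t m < D.t (n + 1) := by linarith [D.hmono hlt]
      have := D.hmono.lt_iff_lt.mp h3
      omega
    | dep1 => exact ih.dep1 he
    | dep2 => exact ih.dep2 he

/-- Pathwise dominance of the OR system by the UB system: for all `n ≥ 0`,
`Q₁⁻(n) ≤ Q̂₁⁻(n)`, `Q₁⁺(n) ≤ Q̂₁⁺(n)`, `Q₂(n) ≤ Q̂₂(n)`,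
`Q₁(n) + R₁(n) ≤ Q̂₁(n) + R̂₁(n)`, and `R₂(n) + R₃(n) ≤ R̂₂(n) + R̂₃(n)`. -/
theorem pathwise_dominance (D : NDriving) (n : ℕ) :
    orQ1m D n ≤ ubQ1m D n ∧
    orQ1p D n ≤ ubQ1p D n ∧
    orQ2 D n ≤ ubQ2 D n ∧
    orQ1 D n + orR1 D n ≤ ubQ1 D n + ubR1 D n ∧
    orR2 D n + orR3 D n ≤ ubR2 D n + ubR3 D n := by
  have h := coupled_traj D n
  refine ⟨Finset.card_le_card h.q1m_subset, Finset.card_le_card h.q1p_subset,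
    Finset.card_le_card h.q2_subset, h.count, ?_⟩
  have hb := h.busy2
  have ha := h.s2_arr
  simp only [orR2, orR3, ubR2, ubR3]
  grind
end

section
/- Induction step for a type-1 arrival: suppose n ≥ 1 and that after the (n−1)-th event the following hold: 𝒬₁⁻(n−1) ⊆ 𝒬̂₁⁻(n−1), 𝒬₁⁺(n−1) ⊆ 𝒬̂₁⁺(n−1), 𝒬₂(n−1) ⊆ 𝒬̂₂(n−1), Q₁(n−1) + R₁(n−1) ≤ Q̂₁(n−1) + R̂₁(n−1), and R₂(n−1) + R₃(n−1) ≤ R̂₂(n−1) + R̂₃(n−1). If the n-th event e_n is of type (i) (the arrival of a new type-1 job), then Q₁⁻(n) ≤ Q̂₁⁻(n), Q₁⁺(n) ≤ Q̂₁⁺(n), Q₂(n) ≤ Q̂₂(n), Q₁(n) + R₁(n) ≤ Q̂₁(n) + R̂₁(n), and R₂(n) + R₃(n) ≤ R̂₂(n) + R̂₃(n). -/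
/-- A step of the UB system adds at most the current event index to the set of waiting
type-1 jobs with waiting time below the threshold. -/
theorem ubStep_q1m_subset (n : ℕ) (ev : NEvent) (s : NState) :
    (ubStep n ev s).q1m ⊆ insert n s.q1m := by
  have hs : s.q1m ⊆ insert n s.q1m := Finset.subset_insert _ _
  have he (k : ℕ) : s.q1m.erase k ⊆ insert n s.q1m := (Finset.erase_subset _ _).trans hs
  cases ev with
  | arr1 => exact Finset.Subset.refl _
  | arr2 =>
    simp only [ubStep]
    split_ifs <;> exact hs
  | thresh k =>
    simp only [ubStep]
    split_ifs <;> first | exact hs | exact he k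
  | dep1 =>
    simp only [ubStep]
    split
    · exact hs
    · split_ifs <;> exact hs
  | dep2 =>
    simp only [ubStep]
    split
    · exact hs
    · split_ifs <;> exact hs

/-- Jobs in `q1m` of the UB system arrived no later than the current event. -/
theorem le_of_mem_ubTraj_q1m (D : NDriving) {n k : ℕ} (hk : k ∈ (ubTraj D n).q1m) : k ≤ n := by
  induction n with
  | zero => simp [ubTraj, NState.empty] at hk
  | succ n ih =>
    rcases Finset.mem_insert.mp (ubStep_q1m_subset _ _ _ hk) with rfl | h
    · exact le_rfl
    · exact (ih h).trans n.le_succ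

/-- Induction step of the dominance proof for a type-1 arrival (event of type (i)).
Assume that after the `n`-th event: `𝒬₁⁻(n) ⊆ 𝒬̂₁⁻(n)`, `𝒬₁⁺(n) ⊆ 𝒬̂₁⁺(n)`,
`𝒬₂(n) ⊆ 𝒬̂₂(n)`, `Q₁(n) + R₁(n) ≤ Q̂₁(n) + R̂₁(n)`, and
`R₂(n) + R₃(n) ≤ R̂₂(n) + R̂₃(n)`.  If the `(n+1)`-th event is a type-1 arrival (event of type (i)), then
`Q₁⁻(n+1) ≤ Q̂₁⁻(n+1)`, `Q₁⁺(n+1) ≤ Q̂₁⁺(n+1)`, `Q₂(n+1) ≤ Q̂₂(n+1)`,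
`Q₁(n+1) + R₁(n+1) ≤ Q̂₁(n+1) + R̂₁(n+1)`, and
`R₂(n+1) + R₃(n+1) ≤ R̂₂(n+1) + R̂₃(n+1)`. -/
theorem step_arr1 (D : NDriving) (n : ℕ)
    (ih1 : (orTraj D n).q1m ⊆ (ubTraj D n).q1m)
    (ih2 : (orTraj D n).q1p ⊆ (ubTraj D n).q1p)
    (ih3 : (orTraj D n).q2 ⊆ (ubTraj D n).q2)
    (ih4 : orQ1 D n + orR1 D n ≤ ubQ1 D n + ubR1 D n)
    (ih5 : orR2 D n + orR3 D n ≤ ubR2 D n + ubR3 D n)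
    (hev : D.e (n + 1) = NEvent.arr1) :
    orQ1m D (n + 1) ≤ ubQ1m D (n + 1) ∧
    orQ1p D (n + 1) ≤ ubQ1p D (n + 1) ∧
    orQ2 D (n + 1) ≤ ubQ2 D (n + 1) ∧
    orQ1 D (n + 1) + orR1 D (n + 1) ≤ ubQ1 D (n + 1) + ubR1 D (n + 1) ∧
    orR2 D (n + 1) + orR3 D (n + 1) ≤ ubR2 D (n + 1) + ubR3 D (n + 1) := by
  have hub : ubTraj D (n + 1) =
      { ubTraj D n with q1m := insert (n + 1) (ubTraj D n).q1m } := by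
    simp [ubTraj, ubStep, hev]
  have hfresh : n + 1 ∉ (ubTraj D n).q1m := fun h => by
    have := le_of_mem_ubTraj_q1m D h
    omega
  have hcard := Finset.card_insert_of_notMem hfresh
  have hcard_or := Finset.card_insert_le (n + 1) (orTraj D n).q1m
  have h1 := Finset.card_le_card ih1
  have h2 := Finset.card_le_card ih2
  have h3 := Finset.card_le_card ih3
  by_cases hidle : (orTraj D n).s1 = none ∧ (orTraj D n).q1m = ∅ ∧ (orTraj D n).q1p = ∅
  · have hor : orTraj D (n + 1) = { orTraj D n with s1 := some (n + 1) } := by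
      simp only [orTraj, orStep, hev, if_pos hidle]
    simp only [orQ1m, orQ1p, orQ2, orQ1, orR1, orR2, orR3, ubQ1m, ubQ1p, ubQ2, ubQ1, ubR1, ubR2,
      ubR3, hor, hub, hidle.1, reduceCtorEq, if_true, if_false] at ih4 ih5 ⊢
    refine ⟨?_, h2, h3, ?_, ih5⟩ <;> omega
  · have hor : orTraj D (n + 1) =
        { orTraj D n with q1m := insert (n + 1) (orTraj D n).q1m } := by
      simp only [orTraj, orStep, hev, if_neg hidle]
    simp only [orQ1m, orQ1p, orQ2, orQ1, orR1, orR2, orR3, ubQ1m, ubQ1p, ubQ2, ubQ1, ubR1, ubR2,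
      ubR3, hor, hub] at ih4 ih5 ⊢
    refine ⟨?_, h2, h3, ?_, ih5⟩ <;> omega
end

section
/- Induction step for a potential completion at server 2: suppose n ≥ 1 and that after the (n−1)-th event the following hold: 𝒬₁⁻(n−1) ⊆ 𝒬̂₁⁻(n−1), 𝒬₁⁺(n−1) ⊆ 𝒬̂₁⁺(n−1), 𝒬₂(n−1) ⊆ 𝒬̂₂(n−1), Q₁(n−1) + R₁(n−1) ≤ Q̂₁(n−1) + R̂₁(n−1), and R₂(n−1) + R₃(n−1) ≤ R̂₂(n−1) + R̂₃(n−1). If the n-th event e_n is of type (v) (a potential service completion at server 2), then Q₁⁻(n) ≤ Q̂₁⁻(n), Q₁⁺(n) ≤ Q̂₁⁺(n), Q₂(n) ≤ Q̂₂(n), Q₁(n) + R₁(n) ≤ Q̂₁(n) + R̂₁(n), and R₂(n) + R₃(n) ≤ R̂₂(n) + R̂₃(n). -/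
/-- Waiting jobs are arrivals of the recorded type, server 2 serves only arrivals, and server 2
idles only if no job that it may serve is waiting. -/
structure NState.Consistent (e : ℕ → NEvent) (s : NState) : Prop where
  q1m_arr : ∀ x ∈ s.q1m, e x = NEvent.arr1
  q1p_arr : ∀ x ∈ s.q1p, e x = NEvent.arr1
  q2_arr : ∀ x ∈ s.q2, e x = NEvent.arr2
  s2_arr : ∀ x, s.s2 = some x → e x = NEvent.arr1 ∨ e x = NEvent.arr2
  s2_idle : s.s2 = none → s.q1p = ∅ ∧ s.q2 = ∅

theorem NState.consistent_empty (e : ℕ → NEvent) : NState.empty.Consistent e := by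
  constructor <;> simp [NState.empty]

theorem NState.Consistent.orStep {e : ℕ → NEvent} {s : NState} (hs : s.Consistent e) (n : ℕ) :
    (orStep n (e n) s).Consistent e := by
  obtain ⟨h1, h2, h3, h4, h5⟩ := hs
  obtain ⟨a, p, q, s1, s2⟩ := s
  dsimp only at h1 h2 h3 h4 h5
  cases hev : e n with
  | arr1 => simp only [_root_.orStep]; split_ifs <;> constructor <;> grind
  | arr2 => simp only [_root_.orStep]; split_ifs <;> constructor <;> grind
  | thresh k => simp only [_root_.orStep]; split_ifs <;> constructor <;> grind
  | dep1 =>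
    cases s1 with
    | none => exact ⟨h1, h2, h3, h4, h5⟩
    | some i => simp only [_root_.orStep]; split_ifs <;> constructor <;> grind
  | dep2 =>
    cases s2 with
    | none => exact ⟨h1, h2, h3, h4, h5⟩
    | some i =>
      simp only [_root_.orStep]
      split_ifs with h
      · have hj := Finset.min'_mem _ h
        constructor <;> grind
      · rw [Finset.not_nonempty_iff_eq_empty, Finset.union_eq_empty] at h
        constructor <;> grind

theorem NState.Consistent.ubStep {e : ℕ → NEvent} {s : NState} (hs : s.Consistent e)
    (hidle : s.s1 = none → s.q1p = ∅) (n : ℕ) :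
    (ubStep n (e n) s).Consistent e ∧
      ((ubStep n (e n) s).s1 = none → (ubStep n (e n) s).q1p = ∅) := by
  obtain ⟨h1, h2, h3, h4, h5⟩ := hs
  obtain ⟨a, p, q, s1, s2⟩ := s
  dsimp only at h1 h2 h3 h4 h5 hidle
  cases hev : e n with
  | arr1 => simp only [_root_.ubStep]; refine ⟨?_, by grind⟩; constructor <;> grind
  | arr2 =>
    simp only [_root_.ubStep]
    split_ifs <;> refine ⟨?_, by grind⟩ <;> constructor <;> grind
  | thresh k =>
    simp only [_root_.ubStep]
    split_ifs <;> refine ⟨?_, by grind⟩ <;> constructor <;> grind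
  | dep1 =>
    cases s1 with
    | none => exact ⟨⟨h1, h2, h3, h4, h5⟩, hidle⟩
    | some i =>
      simp only [_root_.ubStep]
      split_ifs <;> refine ⟨?_, by grind⟩ <;> constructor <;> grind
  | dep2 =>
    cases s2 with
    | none => exact ⟨⟨h1, h2, h3, h4, h5⟩, hidle⟩
    | some i =>
      simp only [_root_.ubStep]
      split_ifs with h
      · have hj := Finset.min'_mem _ h
        refine ⟨?_, by grind⟩
        constructor <;> grind
      · rw [Finset.not_nonempty_iff_eq_empty, Finset.union_eq_empty] at h
        refine ⟨?_, by grind⟩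
        constructor <;> grind

theorem orTraj_consistent (D : NDriving) (n : ℕ) : (orTraj D n).Consistent D.e := by
  induction n with
  | zero => exact NState.consistent_empty D.e
  | succ n ih => exact ih.orStep (n + 1)

theorem ubTraj_consistent (D : NDriving) (n : ℕ) :
    (ubTraj D n).Consistent D.e ∧ ((ubTraj D n).s1 = none → (ubTraj D n).q1p = ∅) := by
  induction n with
  | zero => exact ⟨NState.consistent_empty D.e, fun _ => rfl⟩
  | succ n ih => exact ih.1.ubStep ih.2 (n + 1)

theorem orR2_add_orR3 (D : NDriving) (n : ℕ) :
    orR2 D n + orR3 D n = if (orTraj D n).s2 = none then 0 else 1 := by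
  have h := (orTraj_consistent D n).s2_arr
  unfold orR2 orR3
  cases hs : (orTraj D n).s2 with
  | none => rfl
  | some j => rcases h j hs with hj | hj <;> simp [hj]

theorem ubR2_add_ubR3 (D : NDriving) (n : ℕ) :
    ubR2 D n + ubR3 D n = if (ubTraj D n).s2 = none then 0 else 1 := by
  have h := (ubTraj_consistent D n).1.s2_arr
  unfold ubR2 ubR3
  cases hs : (ubTraj D n).s2 with
  | none => rfl
  | some j => rcases h j hs with hj | hj <;> simp [hj]

/-- Induction step of the dominance proof for a potential service completion at server 2 (event of type (v)).
Assume that after the `n`-th event: `𝒬₁⁻(n) ⊆ 𝒬̂₁⁻(n)`, `𝒬₁⁺(n) ⊆ 𝒬̂₁⁺(n)`,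
`𝒬₂(n) ⊆ 𝒬̂₂(n)`, `Q₁(n) + R₁(n) ≤ Q̂₁(n) + R̂₁(n)`, and
`R₂(n) + R₃(n) ≤ R̂₂(n) + R̂₃(n)`.  If the `(n+1)`-th event is a potential service completion at server 2 (event of type (v)), then
`Q₁⁻(n+1) ≤ Q̂₁⁻(n+1)`, `Q₁⁺(n+1) ≤ Q̂₁⁺(n+1)`, `Q₂(n+1) ≤ Q̂₂(n+1)`,
`Q₁(n+1) + R₁(n+1) ≤ Q̂₁(n+1) + R̂₁(n+1)`, and
`R₂(n+1) + R₃(n+1) ≤ R̂₂(n+1) + R̂₃(n+1)`. -/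
theorem step_dep2 (D : NDriving) (n : ℕ)
    (ih1 : (orTraj D n).q1m ⊆ (ubTraj D n).q1m)
    (ih2 : (orTraj D n).q1p ⊆ (ubTraj D n).q1p)
    (ih3 : (orTraj D n).q2 ⊆ (ubTraj D n).q2)
    (ih4 : orQ1 D n + orR1 D n ≤ ubQ1 D n + ubR1 D n)
    (ih5 : orR2 D n + orR3 D n ≤ ubR2 D n + ubR3 D n)
    (hev : D.e (n + 1) = NEvent.dep2) :
    orQ1m D (n + 1) ≤ ubQ1m D (n + 1) ∧
    orQ1p D (n + 1) ≤ ubQ1p D (n + 1) ∧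
    orQ2 D (n + 1) ≤ ubQ2 D (n + 1) ∧
    orQ1 D (n + 1) + orR1 D (n + 1) ≤ ubQ1 D (n + 1) + ubR1 D (n + 1) ∧
    orR2 D (n + 1) + orR3 D (n + 1) ≤ ubR2 D (n + 1) + ubR3 D (n + 1) := by
  rw [orR2_add_orR3, ubR2_add_ubR3] at *
  obtain ⟨-, hp, hq, -, hidle⟩ := orTraj_consistent D n
  obtain ⟨⟨-, hp', hq', -, hidle'⟩, hidle1⟩ := ubTraj_consistent D n
  simp only [orQ1, ubQ1, orQ1m, orQ1p, orQ2, orR1, ubQ1m, ubQ1p, ubQ2, ubR1, orTraj, ubTraj,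
    hev] at *
  generalize orTraj D n = s at *
  generalize ubTraj D n = s' at *
  obtain ⟨a, p, q, s1, s2⟩ := s
  obtain ⟨a', p', q', s1', s2'⟩ := s'
  dsimp only at *
  have ha := Finset.card_le_card ih1
  have hpc := Finset.card_le_card ih2
  have hqc := Finset.card_le_card ih3
  have hdisj : ∀ x ∈ p', x ∉ q' := by grind
  have hbusy : ∀ x ∈ p', (if s1' = none then 0 else 1) = 1 := by grind
  cases s2' with
  | none =>
    cases s2 with
    | none => exact ⟨ha, hpc, hqc, ih4, ih5⟩
    | some i => simp at ih5
  | some i' =>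
    by_cases h' : (p' ∪ q').Nonempty
    · simp only [ubStep, h', ↓reduceDIte]
      have hmin' : ∀ x ∈ p' ∪ q', (p' ∪ q').min' h' ≤ x := Finset.min'_le _
      have hj' := Finset.min'_mem _ h'
      generalize (p' ∪ q').min' h' = j' at *
      cases s2 with
      | none =>
        obtain ⟨rfl, rfl⟩ := hidle rfl
        simp only [orStep]
        grind
      | some i =>
        by_cases h : (p ∪ q).Nonempty
        · simp only [orStep, h, ↓reduceDIte]
          have hmin : ∀ x ∈ p ∪ q, (p ∪ q).min' h ≤ x := Finset.min'_le _
          have hj := Finset.min'_mem _ h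
          generalize (p ∪ q).min' h = j at *
          have hpj : p.erase j ⊆ p'.erase j' := fun x hx => by
            simp only [Finset.mem_erase, Finset.mem_union] at *
            grind
          have hqj : q.erase j ⊆ q'.erase j' := fun x hx => by
            simp only [Finset.mem_erase, Finset.mem_union] at *
            grind
          have hpjc := Finset.card_le_card hpj
          have hqjc := Finset.card_le_card hqj
          grind
        · rw [Finset.not_nonempty_iff_eq_empty, Finset.union_eq_empty] at h
          simp only [orStep, h]
          grind
    · rw [Finset.not_nonempty_iff_eq_empty, Finset.union_eq_empty] at h'
      obtain ⟨rfl, rfl⟩ := h'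
      obtain rfl := Finset.subset_empty.mp ih2
      obtain rfl := Finset.subset_empty.mp ih3
      cases s2 <;> simpa [orStep, ubStep] using ⟨ha, ih4⟩
end
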